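/- arXiv:math/0309006 — 3 statements merged into one kernel-verified Lean document; each statement's English description precedes it below -/
import Mathlib

section
/- Suppose L/K is a finite Galois extension of fields with Galois group G, and V is a finite-dimensional vector space over L. Let 𝒯 be a family of pairwise commuting, diagonalizable L-linear endomorphisms of V, and suppose v ∈ V is a nonzero common eigenvector: T v = a_T • v with a_T ∈ L for every T ∈ 𝒯. Then for every σ ∈ G there exists a nonzero element w of L ⊗_K V such that for every T ∈ 𝒯 one has (id_L ⊗ T)(w) = σ(a_T) • w, where id_L ⊗ T denotes the base change to L ⊗_K V of T regarded as a K-linear map, and the scalar σ(a_T) ∈ L acts through the left tensor factor. -/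
open scoped TensorProduct

/-- The `K`-linear map `L ⊗[K] L → L ⊗[K] V` sending `x ⊗ y` to `σ x ⊗ y • v`. -/
noncomputable def twistedOrbitMap {K L V : Type*} [Field K] [Field L] [Algebra K L]
    [AddCommGroup V] [Module K V] [Module L V] [IsScalarTower K L V]
    (σ : L ≃ₐ[K] L) (v : V) : L ⊗[K] L →ₗ[K] L ⊗[K] V :=
  TensorProduct.map σ.toLinearMap ((LinearMap.toSpanSingleton L V v).restrictScalars K)

section TwistedOrbitMap

variable {K L V : Type*} [Field K] [Field L] [Algebra K L]
  [AddCommGroup V] [Module K V] [Module L V] [IsScalarTower K L V]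

theorem twistedOrbitMap_injective (σ : L ≃ₐ[K] L) {v : V} (hv : v ≠ 0) :
    Function.Injective (twistedOrbitMap σ v) :=
  TensorProduct.map_injective_of_flat_flat _ _ σ.injective (smul_left_injective L hv)

theorem twistedOrbitMap_tmul_one_mul (σ : L ≃ₐ[K] L) (v : V) (c : L) (x : L ⊗[K] L) :
    twistedOrbitMap σ v ((c ⊗ₜ 1) * x) = σ c • twistedOrbitMap σ v x := by
  induction x with
  | zero => simp
  | add x y hx hy => rw [mul_add, map_add, hx, hy, map_add, smul_add]
  | tmul x y => simp [twistedOrbitMap, TensorProduct.smul_tmul']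

theorem baseChange_twistedOrbitMap (σ : L ≃ₐ[K] L) {v : V} {T : Module.End L V} {c : L}
    (hT : T v = c • v) (x : L ⊗[K] L) :
    LinearMap.baseChange L (LinearMap.restrictScalars K (T : V →ₗ[L] V)) (twistedOrbitMap σ v x)
      = twistedOrbitMap σ v ((1 ⊗ₜ c) * x) := by
  induction x with
  | zero => simp
  | add x y hx hy => rw [mul_add, map_add, map_add, map_add, hx, hy]
  | tmul x y => simp [twistedOrbitMap, hT, smul_smul, mul_comm]

end TwistedOrbitMap

/-- Let `L/K` be a finite Galois extension of fields and `V` a finite-dimensional `L`-vector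
space.  Let `𝒯` be a family of pairwise commuting, diagonalizable `L`-linear endomorphisms of
`V`, and suppose `v ≠ 0` is a common eigenvector: `T v = a T • v` for all `T ∈ 𝒯`.  Then for
every `σ` in the Galois group there is a nonzero `w ∈ L ⊗[K] V` with
`(id_L ⊗ T) w = σ (a T) • w` for every `T ∈ 𝒯`, where `id_L ⊗ T` is the base change to
`L ⊗[K] V` of `T` regarded as a `K`-linear map, and `σ (a T) ∈ L` acts through the left tensor
factor. -/
theorem exists_galois_twisted_eigenvector {K L : Type*} [Field K] [Field L] [Algebra K L]
    [FiniteDimensional K L] [IsGalois K L]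
    {V : Type*} [AddCommGroup V] [Module K V] [Module L V] [IsScalarTower K L V]
    [FiniteDimensional L V]
    (𝒯 : Set (Module.End L V))
    (hcomm : ∀ S ∈ 𝒯, ∀ T ∈ 𝒯, S * T = T * S)
    (hdiag : ∀ T ∈ 𝒯, (⨆ μ : L, Module.End.eigenspace T μ) = ⊤)
    (v : V) (hv : v ≠ 0)
    (a : Module.End L V → L)
    (ha : ∀ T ∈ 𝒯, T v = a T • v)
    (σ : L ≃ₐ[K] L) :
    ∃ w : L ⊗[K] V, w ≠ 0 ∧
      ∀ T ∈ 𝒯,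
        LinearMap.baseChange L (LinearMap.restrictScalars K (T : V →ₗ[L] V)) w
          = σ (a T) • w := by
  have := Algebra.FormallyUnramified.of_isSeparable K L
  refine ⟨twistedOrbitMap σ v (Algebra.FormallyUnramified.elem K L), ?_, fun T hT => ?_⟩
  · refine (map_ne_zero_iff _ (twistedOrbitMap_injective σ hv)).mpr fun h => ?_
    have h_one := Algebra.FormallyUnramified.lmul_elem (R := K) (S := L)
    rw [h, map_zero] at h_one
    exact zero_ne_one h_one
  · rw [baseChange_twistedOrbitMap σ (ha T hT),
      Algebra.FormallyUnramified.one_tmul_mul_elem, twistedOrbitMap_tmul_one_mul]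
end

section
/- Let p be a prime, q = p^a a prime power, and k an algebraically closed field equipped with a field embedding of 𝔽_q (so k has characteristic p). Let V be a nonzero finite-dimensional k-vector space and ρ : GL_g(𝔽_q) → GL(V) an irreducible representation. Then the restriction of ρ to the subgroup SL_g(𝔽_q) is irreducible: every k-subspace W ⊆ V with ρ(M)W ⊆ W for all M ∈ SL_g(𝔽_q) is 0 or V. -/
open Matrix

namespace Matrix

section Identities

variable {n F : Type*} [Fintype n] [DecidableEq n] [Field F]

theorem swap_mul_transvection (i j k l : n) (c : F) :
    swap F i j * transvection k l c =
      transvection (Equiv.swap i j k) (Equiv.swap i j l) c * swap F i j := by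
  simp only [transvection, mul_add, add_mul, mul_one, one_mul]
  congr 1
  simp only [swap, PEquiv.toMatrix_toPEquiv_mul, PEquiv.mul_toMatrix_toPEquiv]
  ext a b
  simp only [submatrix_apply, single_apply, id, Equiv.symm_swap]
  congr 1
  rw [Equiv.swap_apply_eq_iff, Equiv.swap_apply_eq_iff]
  simp

theorem swap_mul_diagonal (i j : n) (d : n → F) :
    swap F i j * diagonal d = diagonal (d ∘ Equiv.swap i j) * swap F i j := by
  simp only [swap, PEquiv.toMatrix_toPEquiv_mul, PEquiv.mul_toMatrix_toPEquiv]
  ext a b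
  simp [diagonal_apply, Equiv.swap_apply_eq_iff]

theorem swap_braid {a b c : n} (hab : a ≠ b) (hac : a ≠ c) (hbc : b ≠ c) :
    swap F a b * swap F b c * swap F a b = swap F b c * swap F a b * swap F b c := by
  simp only [swap, ← permMatrix_mul]
  congr 1
  have h₁ : Equiv.swap b c * Equiv.swap a b * Equiv.swap b c = Equiv.swap c a :=
    Equiv.swap_mul_swap_mul_swap hab hac
  have h₂ : Equiv.swap a b * Equiv.swap b c * Equiv.swap a b = Equiv.swap c a := by
    rw [Equiv.swap_comm a b, Equiv.swap_comm b c, Equiv.swap_comm c a]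
    exact Equiv.swap_mul_swap_mul_swap hbc.symm hac.symm
  rw [← mul_assoc, ← mul_assoc, h₁, h₂]

theorem swap_commute {a b c d : n} (hac : a ≠ c) (had : a ≠ d) (hbc : b ≠ c) (hbd : b ≠ d) :
    swap F a b * swap F c d = swap F c d * swap F a b := by
  simp only [swap, ← permMatrix_mul]
  congr 1
  ext x
  simp only [Equiv.Perm.mul_apply, Equiv.swap_apply_def]
  grind

theorem diagonal_mul_transvection {d : n → F} (i j : n) (hj : d j ≠ 0) (c : F) :
    diagonal d * transvection i j c = transvection i j (d i * c * (d j)⁻¹) * diagonal d := by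
  simp only [transvection, mul_add, add_mul, mul_one, one_mul]
  congr 1
  ext a b
  simp only [diagonal_mul, mul_diagonal, single_apply]
  split_ifs with h
  · rw [← h.1, ← h.2]; field_simp
  · simp

theorem transvection_mul_diagonal {d : n → F} (i j : n) (hi : d i ≠ 0) (c : F) :
    transvection i j c * diagonal d = diagonal d * transvection i j ((d i)⁻¹ * c * d j) := by
  simp only [transvection, mul_add, add_mul, mul_one, one_mul]
  congr 1
  ext a b
  simp only [diagonal_mul, mul_diagonal, single_apply]
  split_ifs with h
  · rw [← h.1, ← h.2]; field_simp
  · simp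

theorem transvection_commute {i j k l : n} (hjk : j ≠ k) (hil : i ≠ l) (c d : F) :
    transvection i j c * transvection k l d = transvection k l d * transvection i j c := by
  simp only [transvection, mul_add, add_mul, mul_one, one_mul, single_mul_single_of_ne _ _ _ _ hjk,
    single_mul_single_of_ne _ _ _ _ hil.symm]
  abel

theorem transvection_mul_transvection_chain {i j k : n} (hik : i ≠ k) (c d : F) :
    transvection i j c * transvection j k d =
      transvection j k d * transvection i k (c * d) * transvection i j c := by
  simp [transvection, mul_add, add_mul, hik.symm]
  abel

theorem transvection_mul_swap {i j : n} (hij : i ≠ j) {t : F} (ht : t ≠ 0) :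
    transvection i j t * swap F i j =
      transvection j i t⁻¹ *
        diagonal (Function.update (Function.update 1 i t) j (-t⁻¹)) *
        transvection i j t⁻¹ := by
  have hji := hij.symm
  ext a b
  by_cases hbi : b = i
  · subst hbi
    rw [mul_swap_apply_left, mul_transvection_apply_of_ne _ _ _ _ hij]
    by_cases haj : a = j
    · subst haj
      simp [transvection, hij, hji, ht]
    · by_cases hab : a = b
      · subst hab
        simp [transvection, hij, hji]
      · simp [transvection, hij, haj, hab, Ne.symm haj, Ne.symm hab]
  · by_cases hbj : b = j
    · subst hbj
      rw [mul_swap_apply_right, mul_transvection_apply_same]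
      simp only [mul_diagonal]
      by_cases hai : a = i
      · subst hai
        simp [transvection, hij, hji, ht]
      · by_cases hab : a = b
        · subst hab
          simp [transvection, hij, hji, ht]
        · simp [transvection, hij, hji, hai, hab, Ne.symm hai, Ne.symm hab]
    · rw [mul_swap_of_ne hbi hbj, mul_transvection_apply_of_ne _ _ _ _ hbj, mul_diagonal]
      simp [transvection, hbi, hbj, Ne.symm hbi, Ne.symm hbj]
theorem transvection_swap_mul_mul {a b c : n} (hab : a ≠ b) (hac : a ≠ c) (hbc : b ≠ c)
    (r s t : F) :
    transvection a b r * swap F a b * (transvection b c s * swap F b c) *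
        (transvection a b t * swap F a b) =
      transvection a b r * transvection a c s * transvection b c t *
        (swap F a b * swap F b c * swap F a b) := by
  have h₁ : swap F a b * transvection b c s = transvection a c s * swap F a b := by
    rw [swap_mul_transvection, Equiv.swap_apply_right,
      Equiv.swap_apply_of_ne_of_ne hac.symm hbc.symm]
  have h₂ : swap F b c * transvection a b t = transvection a c t * swap F b c := by
    rw [swap_mul_transvection, Equiv.swap_apply_left, Equiv.swap_apply_of_ne_of_ne hab hac]
  have h₃ : swap F a b * transvection a c t = transvection b c t * swap F a b := by
    rw [swap_mul_transvection, Equiv.swap_apply_left,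
      Equiv.swap_apply_of_ne_of_ne hac.symm hbc.symm]
  calc _ = transvection a b r * (swap F a b * transvection b c s) *
        (swap F b c * transvection a b t) * swap F a b := by simp only [mul_assoc]
    _ = transvection a b r * transvection a c s * (swap F a b * transvection a c t) *
        swap F b c * swap F a b := by rw [h₁, h₂]; simp only [mul_assoc]
    _ = _ := by rw [h₃]; simp only [mul_assoc]

theorem transvection_swap_mul_mul' {a b c : n} (hab : a ≠ b) (hac : a ≠ c) (hbc : b ≠ c)
    (r s t : F) :
    transvection b c r * swap F b c * (transvection a b s * swap F a b) *
        (transvection b c t * swap F b c) =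
      transvection b c r * transvection a c s * transvection a b t *
        (swap F b c * swap F a b * swap F b c) := by
  have h₁ : swap F b c * transvection a b s = transvection a c s * swap F b c := by
    rw [swap_mul_transvection, Equiv.swap_apply_left, Equiv.swap_apply_of_ne_of_ne hab hac]
  have h₂ : swap F a b * transvection b c t = transvection a c t * swap F a b := by
    rw [swap_mul_transvection, Equiv.swap_apply_right,
      Equiv.swap_apply_of_ne_of_ne hac.symm hbc.symm]
  have h₃ : swap F b c * transvection a c t = transvection a b t * swap F b c := by
    rw [swap_mul_transvection, Equiv.swap_apply_right, Equiv.swap_apply_of_ne_of_ne hab hac]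
  calc _ = transvection b c r * (swap F b c * transvection a b s) *
        (swap F a b * transvection b c t) * swap F b c := by simp only [mul_assoc]
    _ = transvection b c r * transvection a c s * (swap F b c * transvection a c t) *
        swap F a b * swap F b c := by rw [h₁, h₂]; simp only [mul_assoc]
    _ = _ := by rw [h₃]; simp only [mul_assoc]

end Identities
end Matrix

namespace Matrix

section Unitriangular

variable {n F : Type*} [DecidableEq n] [Field F]

/-- A matrix is unitriangular for the weight `b` if it agrees with the identity matrix at all
entries `(i, j)` outside the region `b i < b j`. -/
def IsUnitriangular (b : n → ℤ) (M : Matrix n n F) : Prop :=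
  ∀ i j, ¬ b i < b j → M i j = (1 : Matrix n n F) i j

variable {b : n → ℤ}

theorem isUnitriangular_one : IsUnitriangular b (1 : Matrix n n F) := fun _ _ _ => rfl

theorem isUnitriangular_transvection {i j : n} (h : b i < b j) (c : F) :
    IsUnitriangular b (transvection i j c) := by
  intro k l hkl
  have : ¬ (i = k ∧ j = l) := by rintro ⟨rfl, rfl⟩; exact hkl h
  simp [transvection, this]

variable [Fintype n]

theorem IsUnitriangular.mul {M N : Matrix n n F} (hM : IsUnitriangular b M)
    (hN : IsUnitriangular b N) : IsUnitriangular b (M * N) := by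
  intro i j hij
  have key : ∀ l, M i l * N l j = (1 : Matrix n n F) i l * (1 : Matrix n n F) l j := by
    intro l
    by_cases hil : b i < b l
    · have hlj : ¬ b l < b j := fun h => hij (hil.trans h)
      rw [hN l j hlj]
      rcases eq_or_ne l j with rfl | hne
      · exact absurd hil hij
      · simp [one_apply_ne hne]
    · rw [hM i l hil]
      rcases eq_or_ne i l with rfl | hne
      · rw [hN _ _ hij]
      · simp [one_apply_ne hne]
  rw [mul_apply, Finset.sum_congr rfl fun l _ => key l, ← mul_apply, one_mul]

theorem IsUnitriangular.pow {M : Matrix n n F} (hM : IsUnitriangular b M) (m : ℕ) :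
    IsUnitriangular b (M ^ m) := by
  induction m with
  | zero => simpa using isUnitriangular_one
  | succ m ih => rw [pow_succ]; exact ih.mul hM

theorem IsUnitriangular.exists_pow_prime_pow_eq_one {p : ℕ} [Fact p.Prime] [CharP F p]
    {M : Matrix n n F} (hM : IsUnitriangular b M) : ∃ m, M ^ p ^ m = 1 := by
  have key : ∀ (m : ℕ) (i j : n), ¬ b i + m ≤ b j → ((M - 1) ^ m) i j = 0 := by
    intro m
    induction m with
    | zero =>
      intro i j hij
      rw [pow_zero, one_apply_ne]
      rintro rfl
      simp at hij
    | succ m ih =>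
      intro i j hij
      rw [pow_succ, mul_apply]
      refine Finset.sum_eq_zero fun l _ => ?_
      by_cases hil : b i + m ≤ b l
      · rw [sub_apply, hM l j (by push_cast at hij; omega), sub_self, mul_zero]
      · rw [ih i l hil, zero_mul]
  obtain ⟨m, hm⟩ : ∃ m : ℕ, ∀ i j, b j - b i < m := by
    obtain ⟨B, hB⟩ := (Set.finite_range fun x : n × n => b x.2 - b x.1).bddAbove
    refine ⟨(B + 1).toNat, fun i j => ?_⟩
    have := hB ⟨(i, j), rfl⟩
    simp only at this
    omega
  refine ⟨m, ?_⟩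
  have hmp : m ≤ p ^ m := (Nat.lt_pow_self (Fact.out : p.Prime).one_lt).le
  have hzero : (M - 1) ^ m = 0 := by
    ext i j
    exact key m i j (by have := hm i j; omega)
  by_cases hn : IsEmpty n
  · exact Subsingleton.elim _ _
  · have : Nonempty n := not_isEmpty_iff.mp hn
    have h := sub_pow_char_pow_of_commute (p := p) (n := m) (Commute.one_right M)
    rw [pow_eq_zero_of_le hmp hzero, one_pow] at h
    exact (sub_eq_zero.mp h.symm)

theorem IsUnitriangular.det_eq_one {p : ℕ} [Fact p.Prime] [CharP F p]
    {M : Matrix n n F} (hM : IsUnitriangular b M) : M.det = 1 := by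
  obtain ⟨m, hm⟩ := hM.exists_pow_prime_pow_eq_one (p := p)
  have h : (M.det - 1) ^ p ^ m = 0 := by
    rw [sub_pow_char_pow, ← det_pow, hm, det_one, one_pow, sub_self]
  exact sub_eq_zero.mp (pow_eq_zero_iff (pow_ne_zero _ (Fact.out : p.Prime).ne_zero) |>.mp h)

variable (b F) in
/-- The group of matrices that are unitriangular for the weight `b`. -/
def unitriangularSubgroup (p : ℕ) [Fact p.Prime] [CharP F p] : Subgroup (Matrix n n F)ˣ where
  carrier := {u | IsUnitriangular b (u : Matrix n n F)}
  one_mem' := isUnitriangular_one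
  mul_mem' hu hv := hu.mul hv
  inv_mem' := by
    intro u hu
    obtain ⟨m, hm⟩ := IsUnitriangular.exists_pow_prime_pow_eq_one (p := p) hu
    have hinv : u⁻¹ = u ^ (p ^ m - 1) := by
      rw [inv_eq_iff_mul_eq_one, ← pow_succ',
        Nat.sub_add_cancel (Nat.one_le_pow _ _ (Fact.out : p.Prime).pos)]
      exact Units.ext (by simpa using hm)
    rw [Set.mem_ofPred_eq, hinv, Units.val_pow_eq_pow_val]
    exact IsUnitriangular.pow hu _

theorem isPGroup_unitriangularSubgroup (p : ℕ) [Fact p.Prime] [CharP F p] :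
    IsPGroup p (unitriangularSubgroup F b p) := by
  rw [isPGroup_iff_pow_pow_eq_one]
  rintro ⟨u, hu⟩
  obtain ⟨m, hm⟩ := IsUnitriangular.exists_pow_prime_pow_eq_one (p := p) hu
  exact ⟨m, Subtype.ext (Units.ext (by simpa using hm))⟩

theorem IsUnitriangular.exists_unit {p : ℕ} [Fact p.Prime] [CharP F p] {M : Matrix n n F}
    (hM : IsUnitriangular b M) :
    ∃ u ∈ unitriangularSubgroup F b p, (u : Matrix n n F) = M :=
  ⟨nonsingInvUnit M (by rw [hM.det_eq_one (p := p)]; exact isUnit_one), hM, rfl⟩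

end Unitriangular

end Matrix

section FixedVectors

/-- A finite `p`-group acting on a vector space in characteristic `p` has a nonzero fixed vector in
every nonzero invariant subspace. -/
theorem IsPGroup.exists_fixed_vector {p : ℕ} [Fact p.Prime] {P k V : Type*} [Group P] [Finite P]
    (hP : IsPGroup p P) [Field k] [CharP k p] [AddCommGroup V] [Module k V]
    (φ : P →* Module.End k V) {D : Submodule k V} (hD : D ≠ ⊥)
    (hstab : ∀ g, ∀ x ∈ D, φ g x ∈ D) :
    ∃ x ∈ D, x ≠ 0 ∧ ∀ g, φ g x = x := by
  obtain ⟨v, hv, hv0⟩ := D.exists_mem_ne_zero_of_ne_bot hD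
  let S : AddSubgroup V := AddSubgroup.closure (Set.range fun g => φ g v)
  have hvS : v ∈ S := AddSubgroup.subset_closure ⟨1, by simp⟩
  have hSD : S ≤ D.toAddSubgroup := by
    rw [AddSubgroup.closure_le]
    rintro _ ⟨g, rfl⟩
    exact hstab g v hv
  have hS : ∀ g, ∀ x ∈ S, φ g x ∈ S := by
    intro g x hx
    induction hx using AddSubgroup.closure_induction with
    | mem x hx =>
      obtain ⟨h, rfl⟩ := hx
      exact AddSubgroup.subset_closure ⟨g * h, by simp⟩
    | zero => simp
    | add x y _ _ hx hy => rw [map_add]; exact S.add_mem hx hy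
    | neg x _ hx => rw [map_neg]; exact S.neg_mem hx
  have hp0 : ∀ x : V, p • x = 0 := fun x => by
    rw [← Nat.cast_smul_eq_nsmul k, CharP.cast_eq_zero, zero_smul]
  have : AddGroup.FG S := by
    rw [AddGroup.fg_iff_addSubgroup_fg]
    exact ⟨(Set.finite_range fun g => φ g v).toFinset, by simp [S]⟩
  have hfin : Finite S := by
    apply AddCommGroup.finite_of_fg_isAddTorsion
    intro x
    exact isOfFinAddOrder_iff_nsmul_eq_zero.mpr
      ⟨p, (Fact.out : p.Prime).pos, Subtype.ext (hp0 x)⟩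
  let act : MulAction P S :=
    { smul := fun g x => ⟨φ g x, hS g x x.2⟩
      one_smul := fun x => Subtype.ext (by change φ 1 _ = _; simp)
      mul_smul := fun g h x => Subtype.ext (by change φ (g * h) _ = φ g (φ h _); simp) }
  have hcard : p ∣ Nat.card S := by
    have : addOrderOf (⟨v, hvS⟩ : S) = p :=
      addOrderOf_eq_prime (Subtype.ext (hp0 v)) fun h => hv0 (congrArg Subtype.val h)
    exact this ▸ addOrderOf_dvd_natCard _
  obtain ⟨x, hx, hx0⟩ := hP.exists_fixed_point_of_prime_dvd_card_of_fixed_point S hcard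
    (a := 0) (fun g => Subtype.ext (map_zero (φ g)))
  exact ⟨x, hSD x.2, fun h => hx0 (Subtype.ext h.symm), fun g => congrArg Subtype.val (hx g)⟩

/-- A commuting family of endomorphisms over an algebraically closed field has a common eigenvector
in every nonzero invariant finite-dimensional subspace. -/
theorem Module.End.exists_common_eigenvector {ι k V : Type*} [Field k] [IsAlgClosed k]
    [AddCommGroup V] [Module k V] [FiniteDimensional k V] (f : ι → Module.End k V)
    (hf : ∀ i j, Commute (f i) (f j)) {D : Submodule k V} (hD : D ≠ ⊥)
    (hstab : ∀ i, ∀ x ∈ D, f i x ∈ D) :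
    ∃ x ∈ D, x ≠ 0 ∧ ∀ i, ∃ c : k, f i x = c • x := by
  induction D using WellFoundedLT.induction with
  | ind D ih =>
  by_cases hscalar : ∀ i, ∃ c : k, ∀ x ∈ D, f i x = c • x
  · obtain ⟨x, hx, hx0⟩ := D.exists_mem_ne_zero_of_ne_bot hD
    exact ⟨x, hx, hx0, fun i => (hscalar i).imp fun c hc => hc x hx⟩
  · push Not at hscalar
    obtain ⟨i, hi⟩ := hscalar
    have : Nontrivial D := Submodule.nontrivial_iff_ne_bot.mpr hD
    obtain ⟨c, hc⟩ := Module.End.exists_eigenvalue ((f i).restrict (hstab i))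
    obtain ⟨⟨y, hyD⟩, hy⟩ := hc.exists_hasEigenvector
    have hyc : f i y = c • y := congrArg Subtype.val hy.apply_eq_smul
    let E : Submodule k V := D ⊓ Module.End.eigenspace (f i) c
    have hE : E ≠ ⊥ := by
      refine Submodule.ne_bot_iff _ |>.mpr ⟨y, ⟨hyD, Module.End.mem_eigenspace_iff.mpr hyc⟩, ?_⟩
      exact fun h => hy.2 (Subtype.ext h)
    have hlt : E < D := by
      refine lt_of_le_of_ne inf_le_left fun h => ?_
      obtain ⟨x, hx, hne⟩ := hi c
      rw [← h] at hx
      exact hne (Module.End.mem_eigenspace_iff.mp hx.2)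
    obtain ⟨x, hx, hx0, h⟩ := ih E hlt hE fun j x hx =>
      ⟨hstab j x hx.1, Module.End.mem_eigenspace_iff.mpr (by
        rw [← Module.End.mul_apply, (hf i j).eq, Module.End.mul_apply,
          Module.End.mem_eigenspace_iff.mp hx.2, map_smul])⟩
    exact ⟨x, hx.1, hx0, h⟩

end FixedVectors

namespace Matrix

section RankOneOperators

variable {n F k V : Type*} [Fintype n] [DecidableEq n] [Field F] [Fintype F] [Field k]
  [AddCommGroup V] [Module k V] (A : Matrix n n F →* Module.End k V)

/-- The operator `∑ₓ A (x s)`, where `x` runs over the root subgroup of `(i, j)` and `s` is the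
swap of `i` and `j`. -/
def rankOneOp (i j : n) : Module.End k V :=
  ∑ c : F, A (transvection i j c * swap F i j)

theorem rankOneOp_mul (i j k l : n) :
    rankOneOp A i j * rankOneOp A k l =
      ∑ c : F, ∑ d : F, A (transvection i j c * swap F i j * (transvection k l d * swap F k l)) := by
  simp only [rankOneOp, Finset.sum_mul, Finset.mul_sum, map_mul]
  exact Finset.sum_comm

theorem rankOneOp_apply (i j : n) (v : V) :
    rankOneOp A i j v = ∑ c : F, A (transvection i j c) (A (swap F i j) v) := by
  simp [rankOneOp]

theorem rankOneOp_commute {a b c d : n} (hac : a ≠ c) (had : a ≠ d) (hbc : b ≠ c) (hbd : b ≠ d) :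
    rankOneOp A a b * rankOneOp A c d = rankOneOp A c d * rankOneOp A a b := by
  rw [rankOneOp_mul, rankOneOp_mul, Finset.sum_comm]
  refine Finset.sum_congr rfl fun s _ => Finset.sum_congr rfl fun t _ => congrArg A ?_
  have h₁ : swap F a b * transvection c d s = transvection c d s * swap F a b := by
    rw [swap_mul_transvection, Equiv.swap_apply_of_ne_of_ne hac.symm hbc.symm,
      Equiv.swap_apply_of_ne_of_ne had.symm hbd.symm]
  have h₂ : swap F c d * transvection a b t = transvection a b t * swap F c d := by
    rw [swap_mul_transvection, Equiv.swap_apply_of_ne_of_ne hac had,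
      Equiv.swap_apply_of_ne_of_ne hbc hbd]
  calc transvection a b t * swap F a b * (transvection c d s * swap F c d)
      = transvection a b t * (swap F a b * transvection c d s) * swap F c d := by
        simp only [mul_assoc]
    _ = (transvection a b t * transvection c d s) * (swap F a b * swap F c d) := by
        rw [h₁]; simp only [mul_assoc]
    _ = (transvection c d s * transvection a b t) * (swap F c d * swap F a b) := by
        rw [transvection_commute hbc had, swap_commute hac had hbc hbd]
    _ = transvection c d s * (transvection a b t * swap F c d) * swap F a b := by
        simp only [mul_assoc]
    _ = _ := by rw [← h₂]; simp only [mul_assoc]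

theorem rankOneOp_mul_mul (i j k l q r : n) :
    rankOneOp A i j * rankOneOp A k l * rankOneOp A q r =
      ∑ c : F, ∑ d : F, ∑ e : F, A (transvection i j c * swap F i j *
        (transvection k l d * swap F k l) * (transvection q r e * swap F q r)) := by
  rw [rankOneOp_mul]
  simp only [rankOneOp, Finset.sum_mul, Finset.mul_sum, map_mul]
  rw [Finset.sum_comm]
  refine Finset.sum_congr rfl fun c _ => ?_
  rw [Finset.sum_comm]

theorem rankOneOp_braid {a b c : n} (hab : a ≠ b) (hac : a ≠ c) (hbc : b ≠ c) :
    rankOneOp A a b * rankOneOp A b c * rankOneOp A a b =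
      rankOneOp A b c * rankOneOp A a b * rankOneOp A b c := by
  simp only [rankOneOp_mul_mul, transvection_swap_mul_mul hab hac hbc,
    transvection_swap_mul_mul' hab hac hbc, swap_braid hab hac hbc]
  have key : ∀ r s t : F, transvection a b r * transvection a c s * transvection b c t =
      transvection b c t * transvection a c (s + r * t) * transvection a b r := by
    intro r s t
    rw [transvection_commute hab.symm hac, mul_assoc,
      transvection_mul_transvection_chain hac, ← mul_assoc, ← mul_assoc,
      transvection_commute hbc.symm hac, mul_assoc (transvection b c t),
      transvection_mul_transvection_same _ _ hac]
  calc _ = ∑ r : F, ∑ t : F, ∑ s : F, A (transvection b c t * transvection a c (s + r * t) *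
        transvection a b r * (swap F b c * swap F a b * swap F b c)) := by
        refine Finset.sum_congr rfl fun r _ => ?_
        rw [Finset.sum_comm]
        simp only [key]
    _ = ∑ r : F, ∑ t : F, ∑ s : F, A (transvection b c t * transvection a c s *
        transvection a b r * (swap F b c * swap F a b * swap F b c)) := by
        refine Finset.sum_congr rfl fun r _ => Finset.sum_congr rfl fun t _ => ?_
        exact Fintype.sum_equiv (Equiv.addRight (r * t)) _ _ fun s => rfl
    _ = _ := by
        rw [Finset.sum_comm]
        refine Finset.sum_congr rfl fun t _ => ?_
        rw [Finset.sum_comm]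

theorem exists_rankOneOp_sq_apply_eq_smul (hcard : (Fintype.card F : k) = 0) {i j : n} (hij : i ≠ j)
    {v : V} (hfix : ∀ c, A (transvection i j c) v = v)
    (heig : ∀ d : n → F, (∀ l, d l ≠ 0) → ∃ c : k, A (diagonal d) v = c • v) :
    ∃ c : k, rankOneOp A i j (rankOneOp A i j v) = c • rankOneOp A i j v := by
  have key : ∀ t : F, ∃ c : k, ∑ s : F, A (transvection i j s) (A (swap F i j)
      (A (transvection i j t) (A (swap F i j) v))) = c • rankOneOp A i j v := by
    intro t
    rcases eq_or_ne t 0 with rfl | ht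
    · refine ⟨0, ?_⟩
      have h : A (swap F i j) (A (swap F i j) v) = v := by
        rw [← Module.End.mul_apply, ← map_mul, swap_mul_self, map_one, Module.End.one_apply]
      simp [h, hfix, ← Nat.cast_smul_eq_nsmul k, hcard]
    · obtain ⟨c, hc⟩ := heig (Function.update (Function.update 1 i t) j (-t⁻¹)) (by
        intro l
        by_cases hlj : l = j
        · subst hlj; simp [ht]
        · by_cases hli : l = i
          · subst hli; simp [hlj, ht]
          · simp [hlj, hli])
      refine ⟨c, ?_⟩
      have h : A (swap F i j) (A (transvection i j t) (A (swap F i j) v)) =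
          c • A (transvection i j t⁻¹) (A (swap F i j) v) := by
        rw [← Module.End.mul_apply (A (transvection i j t)), ← map_mul,
          transvection_mul_swap hij ht, map_mul, map_mul]
        simp only [Module.End.mul_apply, hfix, hc, map_smul]
        congr 1
        rw [← Module.End.mul_apply, ← map_mul, swap_mul_transvection]
        simp
      simp only [h, map_smul, ← Finset.smul_sum, rankOneOp_apply]
      congr 1
      refine Fintype.sum_equiv (Equiv.addRight t⁻¹) _ _ fun s => ?_
      rw [← Module.End.mul_apply, ← map_mul, transvection_mul_transvection_same _ _ hij]
      rfl
  choose c hc using key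
  refine ⟨∑ t, c t, ?_⟩
  rw [Finset.sum_smul, ← Finset.sum_congr rfl fun t _ => hc t, Finset.sum_comm,
    rankOneOp_apply A i j (rankOneOp A i j v), rankOneOp_apply A i j v]
  simp only [map_sum]

end RankOneOperators

end Matrix

/-- Endomorphisms satisfying the braid relations, and quadratic relations on an invariant set of
vectors, have common eigenvectors. -/
theorem Module.End.exists_common_eigenvector_of_braid {k V : Type*} [Field k] [AddCommGroup V]
    [Module k V] {S : ℕ → Module.End k V} (hcomm : ∀ i j, i + 1 < j → S i * S j = S j * S i)
    (hbraid : ∀ i, S i * S (i + 1) * S i = S (i + 1) * S i * S (i + 1)) {H : V → Prop}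
    (hH : ∀ i v, H v → H (S i v)) (hsq : ∀ i v, H v → ∃ c : k, S i (S i v) = c • S i v) {v : V}
    (hv : H v) (hv0 : v ≠ 0) (m : ℕ) :
    ∃ w, H w ∧ w ≠ 0 ∧ ∀ i < m, ∃ c : k, S i w = c • w := by
  induction m with
  | zero => exact ⟨v, hv, hv0, fun i hi => absurd hi (Nat.not_lt_zero i)⟩
  | succ m ih =>
  obtain ⟨w, hw, hw0, heig⟩ := ih
  have descend : ∀ j ≤ m + 1, ∀ w, H w → w ≠ 0 →
      (∀ i ≤ m, i + 1 ≠ j → ∃ c : k, S i w = c • w) →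
      (j ≤ m → ∃ w', w = S j w' ∧ ∀ i, i + 1 = j → ∃ c : k, S i w' = c • w') →
      ∃ w, H w ∧ w ≠ 0 ∧ ∀ i < m + 1, ∃ c : k, S i w = c • w := by
    intro j
    induction j with
    | zero =>
      exact fun _ w hw hw0 he _ => ⟨w, hw, hw0, fun i hi => he i (by omega) (by omega)⟩
    | succ j ihj =>
      intro hj w hw hw0 he hpre
      by_cases hz : S j w = 0
      · refine ⟨w, hw, hw0, fun i hi => ?_⟩
        rcases eq_or_ne i j with rfl | hne
        · exact ⟨0, by rw [hz, zero_smul]⟩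
        · exact he i (by omega) (by omega)
      · refine ihj (by omega) (S j w) (hH j w hw) hz (fun i hi hij => ?_)
          fun _ => ⟨w, rfl, fun i hi => he i (by omega) (by omega)⟩
        have far : S i * S j = S j * S i → i ≠ j → ∃ c : k, S i (S j w) = c • S j w := by
          intro h hne
          obtain ⟨c, hc⟩ := he i hi (by omega)
          exact ⟨c, by rw [← Module.End.mul_apply, h, Module.End.mul_apply, hc, map_smul]⟩
        rcases lt_trichotomy i j with hlt | rfl | hgt
        · exact far (hcomm i j (by omega)) hlt.ne
        · exact hsq i w hw
        · by_cases hadj : i = j + 1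
          · subst hadj
            obtain ⟨w', rfl, hw'⟩ := hpre (by omega)
            obtain ⟨c, hc⟩ := hw' j rfl
            refine ⟨c, ?_⟩
            have h := LinearMap.congr_fun (hbraid j) w'
            simp only [Module.End.mul_apply] at h
            rw [← h, hc, map_smul, map_smul]
          · exact far (hcomm j i (by omega)).symm hgt.ne'
  exact descend (m + 1) le_rfl w hw hw0 (fun i hi hne => heig i (by omega)) fun h => by omega

namespace Matrix

section HighestWeight

variable {g : ℕ} {F k V : Type*} [Field F] [Field k] [AddCommGroup V] [Module k V]
  (A : Matrix (Fin g) (Fin g) F →* Module.End k V)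

/-- A vector fixed by the upper unitriangular matrices on which the diagonal matrices act by
scalars. -/
def IsHighestWeight (v : V) : Prop :=
  (∀ i j, i < j → ∀ c, A (transvection i j c) v = v) ∧
    ∀ d : Fin g → F, (∀ l, d l ≠ 0) → ∃ c : k, A (diagonal d) v = c • v

theorem swap_lt_swap_of_succ_eq {i j : Fin g} (hij : (i : ℕ) + 1 = j) {a b : Fin g} (hab : a < b)
    (hne : ¬ (a = i ∧ b = j)) : Equiv.swap i j a < Equiv.swap i j b := by
  simp only [Equiv.swap_apply_def, Fin.lt_def, Fin.ext_iff] at *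
  split_ifs <;> omega

variable {A} in
theorem IsHighestWeight.rankOneOp [Fintype F] {v : V} (hv : IsHighestWeight A v) {i j : Fin g}
    (hij : (i : ℕ) + 1 = j) : IsHighestWeight A (rankOneOp A i j v) := by
  have hlt : i < j := by rw [Fin.lt_def]; omega
  have hne := hlt.ne
  refine ⟨fun a b hab c => ?_, fun d hd => ?_⟩
  · rw [rankOneOp_apply, map_sum]
    by_cases h : a = i ∧ b = j
    · obtain ⟨rfl, rfl⟩ := h
      refine Fintype.sum_equiv (Equiv.addLeft c) _ _ fun s => ?_
      rw [← Module.End.mul_apply, ← map_mul, transvection_mul_transvection_same _ _ hne]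
      rfl
    · refine Finset.sum_congr rfl fun s _ => ?_
      have hfix : ∀ a b : Fin g, a < b → ¬ (a = i ∧ b = j) → ∀ c,
          A (transvection a b c) (A (Matrix.swap F i j) v) = A (Matrix.swap F i j) v := by
        intro a b hab h c
        have hswap : transvection a b c * Matrix.swap F i j =
            Matrix.swap F i j * transvection (Equiv.swap i j a) (Equiv.swap i j b) c := by
          rw [swap_mul_transvection, Equiv.swap_apply_self, Equiv.swap_apply_self]
        rw [← Module.End.mul_apply, ← map_mul, hswap, map_mul, Module.End.mul_apply,
          hv.1 _ _ (swap_lt_swap_of_succ_eq hij hab h)]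
      by_cases hbi : b = i
      · subst hbi
        have haj : a ≠ j := (hab.trans hlt).ne
        rw [← Module.End.mul_apply, ← map_mul, transvection_mul_transvection_chain haj,
          map_mul, map_mul]
        simp only [Module.End.mul_apply]
        rw [hfix a b hab h, hfix a j (hab.trans hlt) (fun h' => hab.ne h'.1)]
      · by_cases haj : a = j
        · subst haj
          have hib : i ≠ b := (hlt.trans hab).ne
          have hchain : transvection a b c * transvection i a s =
              transvection i a s * (transvection i b (-(s * c)) * transvection a b c) := by
            have := transvection_mul_transvection_chain (F := F) hib s c (j := a)
            rw [← mul_assoc, transvection_commute hlt.ne' hib, mul_assoc, this,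
              ← mul_assoc, ← mul_assoc, transvection_commute hab.ne' hib,
              mul_assoc (transvection a b c),
              transvection_mul_transvection_same _ _ hib, neg_add_cancel, transvection_zero,
              mul_one]
          rw [← Module.End.mul_apply, ← map_mul, hchain, map_mul, map_mul]
          simp only [Module.End.mul_apply]
          rw [hfix a b hab h, hfix i b (hlt.trans hab) (fun h' => hab.ne' h'.2)]
        · rw [← Module.End.mul_apply, ← map_mul, transvection_commute hbi haj, map_mul,
            Module.End.mul_apply, hfix a b hab h]
  · obtain ⟨c, hc⟩ := hv.2 (d ∘ Equiv.swap i j) fun l => hd _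
    refine ⟨c, ?_⟩
    have hdiag : A (diagonal d) (A (Matrix.swap F i j) v) = c • A (Matrix.swap F i j) v := by
      have hswap : diagonal d * Matrix.swap F i j =
          Matrix.swap F i j * diagonal (d ∘ Equiv.swap i j) := by
        rw [swap_mul_diagonal]
        congr 2
        ext l
        simp
      rw [← Module.End.mul_apply, ← map_mul, hswap, map_mul, Module.End.mul_apply, hc, map_smul]
    rw [rankOneOp_apply, map_sum, Finset.smul_sum]
    let e : F ≃ F :=
      (Equiv.mulLeft₀ (d i) (hd i)).trans (Equiv.mulRight₀ (d j)⁻¹ (inv_ne_zero (hd j)))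
    refine Fintype.sum_equiv e _ _ fun s => ?_
    rw [← Module.End.mul_apply, ← map_mul, diagonal_mul_transvection _ _ (hd j), map_mul,
      Module.End.mul_apply, hdiag, map_smul]
    rfl

theorem exists_isHighestWeight {p : ℕ} [Fact p.Prime] [CharP F p] [CharP k p] [Finite F]
    [IsAlgClosed k] [FiniteDimensional k V] [Nontrivial V] :
    ∃ v, IsHighestWeight A v ∧ v ≠ 0 := by
  let b : Fin g → ℤ := fun i => i
  let D : Submodule k V :=
    ⨅ x : {x : Fin g × Fin g × F // x.1 < x.2.1},
      Module.End.eigenspace (A (transvection x.1.1 x.1.2.1 x.1.2.2)) 1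
  have hDmem : ∀ v, v ∈ D ↔ ∀ i j, i < j → ∀ c, A (transvection i j c) v = v := by
    intro v
    simp only [D, Submodule.mem_iInf, Module.End.mem_eigenspace_iff, one_smul, Subtype.forall,
      Prod.forall]
    exact ⟨fun h i j hij c => h i j c hij, fun h i j c hij => h i j hij c⟩
  have hD : D ≠ ⊥ := by
    obtain ⟨x, -, hx0, hx⟩ := (isPGroup_unitriangularSubgroup (F := F) (b := b) p).exists_fixed_vector
      ((A.comp (Units.coeHom _)).comp (unitriangularSubgroup F b p).subtype)
      (D := ⊤) top_ne_bot fun _ _ _ => Submodule.mem_top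
    refine (Submodule.ne_bot_iff _).mpr ⟨x, (hDmem x).mpr fun i j hij c => ?_, hx0⟩
    obtain ⟨u, hu, huM⟩ := (isUnitriangular_transvection (b := b)
      (by simpa [b] using hij) c).exists_unit (p := p)
    rw [← huM]
    exact hx ⟨u, hu⟩
  obtain ⟨v, hv, hv0, h⟩ := Module.End.exists_common_eigenvector
    (fun d : {d : Fin g → F // ∀ l, d l ≠ 0} => A (diagonal d.1))
    (fun d e => by
      rw [Commute, SemiconjBy, ← map_mul, ← map_mul, diagonal_mul_diagonal, diagonal_mul_diagonal]
      simp only [mul_comm]) hD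
    (fun d v hv => (hDmem _).mpr fun i j hij c => by
      rw [← Module.End.mul_apply, ← map_mul, transvection_mul_diagonal _ _ (d.2 i), map_mul,
        Module.End.mul_apply, (hDmem v).mp hv i j hij])
  exact ⟨v, ⟨(hDmem v).mp hv, fun d hd => h ⟨d, hd⟩⟩, hv0⟩

theorem exists_isHighestWeight_rankOneOp_eq_smul {p : ℕ} [Fact p.Prime] [CharP F p] [CharP k p]
    [Fintype F] [IsAlgClosed k] [FiniteDimensional k V] [Nontrivial V] :
    ∃ v, IsHighestWeight A v ∧ v ≠ 0 ∧
      ∀ i j : Fin g, (i : ℕ) + 1 = j → ∃ c : k, rankOneOp A i j v = c • v := by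
  obtain ⟨v, hv, hv0⟩ := exists_isHighestWeight A (p := p)
  have hcard : (Fintype.card F : k) = 0 := by
    rw [CharP.cast_eq_zero_iff k p]
    obtain ⟨m, -, hm⟩ := FiniteField.card F p
    rw [hm]
    exact dvd_pow_self p m.ne_zero
  let S : ℕ → Module.End k V := fun i =>
    if h : i + 1 < g then Matrix.rankOneOp A ⟨i, by omega⟩ ⟨i + 1, h⟩ else 0
  have hS : ∀ i (h : i + 1 < g), S i = Matrix.rankOneOp A ⟨i, by omega⟩ ⟨i + 1, h⟩ :=
    fun i h => dif_pos h
  have hS0 : ∀ i, ¬ i + 1 < g → S i = 0 := fun i h => dif_neg h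
  obtain ⟨w, hw, hw0, heig⟩ := Module.End.exists_common_eigenvector_of_braid (S := S)
    (H := IsHighestWeight A)
    (fun i j hij => by
      by_cases hj : j + 1 < g
      · rw [hS i (by omega), hS j hj]
        apply rankOneOp_commute <;> simp only [ne_eq, Fin.mk.injEq] <;> omega
      · rw [hS0 j hj, mul_zero, zero_mul])
    (fun i => by
      by_cases hi : i + 1 + 1 < g
      · rw [hS i (by omega), hS (i + 1) hi]
        apply rankOneOp_braid <;> simp only [ne_eq, Fin.mk.injEq] <;> omega
      · rw [hS0 (i + 1) hi, mul_zero, zero_mul, zero_mul])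
    (fun i v hv => by
      by_cases hi : i + 1 < g
      · rw [hS i hi]
        exact hv.rankOneOp rfl
      · rw [hS0 i hi]
        exact ⟨by simp, fun _ _ => ⟨0, by simp⟩⟩)
    (fun i v hv => by
      by_cases hi : i + 1 < g
      · rw [hS i hi]
        exact exists_rankOneOp_sq_apply_eq_smul A hcard (by simp) (hv.1 _ _ (by simp)) hv.2
      · exact ⟨0, by simp [hS0 i hi]⟩) hv hv0 g
  refine ⟨w, hw, hw0, fun i j hij => ?_⟩
  obtain ⟨c, hc⟩ := heig i i.2
  refine ⟨c, ?_⟩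
  rw [hS i (by omega)] at hc
  convert hc
  exact hij.symm

end HighestWeight

end Matrix

namespace Matrix

section LowerSpan

variable {g : ℕ} {F k V : Type*} [Field F] [Field k] [AddCommGroup V] [Module k V]
  (A : Matrix (Fin g) (Fin g) F →* Module.End k V)

/-- The weight for which unitriangular means lower unitriangular. -/
def lowerWeight (g : ℕ) : Fin g → ℤ := fun i => -i

/-- The span of the orbit of `v` under the lower unitriangular matrices. -/
def lowerSpan (v : V) : Submodule k V :=
  Submodule.span k ((fun u => A u v) '' {u | IsUnitriangular (lowerWeight g) u})

theorem apply_mem_lowerSpan {v : V} {u : Matrix (Fin g) (Fin g) F}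
    (hu : IsUnitriangular (lowerWeight g) u) : A u v ∈ lowerSpan A v :=
  Submodule.subset_span ⟨u, hu, rfl⟩

theorem self_mem_lowerSpan (v : V) : v ∈ lowerSpan A v := by
  simpa using apply_mem_lowerSpan A (v := v) isUnitriangular_one

theorem apply_mem_lowerSpan_of_forall {v : V} {M : Matrix (Fin g) (Fin g) F}
    (h : ∀ u, IsUnitriangular (lowerWeight g) u → A (M * u) v ∈ lowerSpan A v) {x : V}
    (hx : x ∈ lowerSpan A v) : A M x ∈ lowerSpan A v := by
  have hle : lowerSpan A v ≤ (lowerSpan A v).comap (A M) := by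
    refine Submodule.span_le.mpr ?_
    rintro _ ⟨u, hu, rfl⟩
    have := h u hu
    rwa [map_mul] at this
  exact hle hx

theorem isUnitriangular_conj_diagonal {b : Fin g → ℤ} {u : Matrix (Fin g) (Fin g) F}
    (hu : IsUnitriangular b u) {d : Fin g → F} (hd : ∀ l, d l ≠ 0) :
    ∃ u', IsUnitriangular b u' ∧ diagonal d * u = u' * diagonal d := by
  refine ⟨of fun i j => d i * u i j * (d j)⁻¹, fun i j hij => ?_, ?_⟩
  · rw [of_apply, hu i j hij]
    rcases eq_or_ne i j with rfl | hne
    · simp [hd]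
    · simp [hne]
  · ext i j
    simp [hd]

theorem exists_isUnitriangular_mul_transvection {u : Matrix (Fin g) (Fin g) F}
    (hu : IsUnitriangular (lowerWeight g) u) {i j : Fin g} (hij : (i : ℕ) + 1 = j) :
    ∃ u', IsUnitriangular (lowerWeight g) u' ∧
      swap F i j * u = u' * swap F i j * transvection j i (u j i) := by
  have hlt : i < j := by rw [Fin.lt_def]; omega
  have hw : ∀ a b : Fin g, lowerWeight g a < lowerWeight g b ↔ b < a := by
    intro a b
    simp [lowerWeight]
  let w := u * transvection j i (-u j i)
  have hwU : IsUnitriangular (lowerWeight g) w :=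
    hu.mul (isUnitriangular_transvection ((hw _ _).mpr hlt) _)
  have hwji : w j i = 0 := by
    simp [w, hu j j (lt_irrefl _)]
  refine ⟨swap F i j * w * swap F i j, fun a b hab => ?_, ?_⟩
  · have happ : (swap F i j * w * swap F i j) a b = w (Equiv.swap i j a) (Equiv.swap i j b) := by
      simp [swap, PEquiv.toMatrix_toPEquiv_mul, PEquiv.mul_toMatrix_toPEquiv]
    have hone : (1 : Matrix (Fin g) (Fin g) F) a b =
        (1 : Matrix (Fin g) (Fin g) F) (Equiv.swap i j a) (Equiv.swap i j b) := by
      simp [one_apply]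
    rw [happ, hone]
    by_cases h : Equiv.swap i j b < Equiv.swap i j a
    · by_cases hb : Equiv.swap i j b = i ∧ Equiv.swap i j a = j
      · rw [hb.1, hb.2, hwji, one_apply_ne hlt.ne']
      · refine absurd ((hw _ _).mpr ?_) hab
        simpa using swap_lt_swap_of_succ_eq hij h hb
    · exact hwU _ _ fun h' => h ((hw _ _).mp h')
  · have hwu : w * transvection j i (u j i) = u := by
      rw [mul_assoc, transvection_mul_transvection_same _ _ hlt.ne', neg_add_cancel,
        transvection_zero, mul_one]
    rw [mul_assoc (swap F i j * w), swap_mul_self, mul_one, mul_assoc, hwu]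

variable {A}

theorem swap_apply_mem_lowerSpan [Fintype F] {v : V} (hv : IsHighestWeight A v)
    {i j : Fin g} (hij : (i : ℕ) + 1 = j) (heig : ∃ c : k, rankOneOp A i j v = c • v) {x : V}
    (hx : x ∈ lowerSpan A v) : A (swap F i j) x ∈ lowerSpan A v := by
  have hlt : i < j := by rw [Fin.lt_def]; omega
  have hlow : ∀ t : F, IsUnitriangular (lowerWeight g) (transvection j i t) := fun t =>
    isUnitriangular_transvection (by simpa [lowerWeight] using hlt) t
  have hne0 : ∀ t : F, t ≠ 0 → ∃ c : k,
      A (transvection i j t * swap F i j) v = c • A (transvection j i t⁻¹) v := by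
    intro t ht
    obtain ⟨c, hc⟩ := hv.2 (Function.update (Function.update 1 i t) j (-t⁻¹)) (by
      intro l
      by_cases hlj : l = j
      · subst hlj; simp [ht]
      · by_cases hli : l = i
        · subst hli; simp [hlj, ht]
        · simp [hlj, hli])
    refine ⟨c, ?_⟩
    rw [transvection_mul_swap hlt.ne ht, map_mul, map_mul]
    simp only [Module.End.mul_apply, hv.1 i j hlt, hc, map_smul]
  have hswap : A (swap F i j) v ∈ lowerSpan A v := by
    obtain ⟨c, hc⟩ := heig
    classical
    have hsum : A (swap F i j) v =
        c • v - ∑ t ∈ Finset.univ.erase (0 : F), A (transvection i j t * swap F i j) v := by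
      rw [eq_sub_iff_add_eq, ← hc, rankOneOp, LinearMap.sum_apply,
        ← Finset.add_sum_erase _ _ (Finset.mem_univ (0 : F)), transvection_zero, one_mul]
    rw [hsum]
    refine Submodule.sub_mem _ (Submodule.smul_mem _ _ (self_mem_lowerSpan A v))
      (Submodule.sum_mem _ fun t ht => ?_)
    obtain ⟨c', hc'⟩ := hne0 t (Finset.ne_of_mem_erase ht)
    rw [hc']
    exact Submodule.smul_mem _ _ (apply_mem_lowerSpan A (hlow _))
  have hunip : ∀ u, IsUnitriangular (lowerWeight g) u → ∀ y ∈ lowerSpan A v,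
      A u y ∈ lowerSpan A v := fun u hu y hy =>
    apply_mem_lowerSpan_of_forall A (fun u' hu' => apply_mem_lowerSpan A (hu.mul hu')) hy
  refine apply_mem_lowerSpan_of_forall A (fun u hu => ?_) hx
  obtain ⟨u', hu', h⟩ := exists_isUnitriangular_mul_transvection hu hij
  rw [h, mul_assoc, map_mul, Module.End.mul_apply]
  refine hunip u' hu' _ ?_
  rcases eq_or_ne (u j i) 0 with h0 | h0
  · rwa [h0, transvection_zero, mul_one]
  · obtain ⟨c, hc⟩ := hne0 _ h0
    rw [swap_mul_transvection, Equiv.swap_apply_left, Equiv.swap_apply_right, hc]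
    exact Submodule.smul_mem _ _ (apply_mem_lowerSpan A (hlow _))

theorem apply_mem_lowerSpan_of_det_ne_zero [Fintype F] {v : V} (hv : IsHighestWeight A v)
    (heig : ∀ i j : Fin g, (i : ℕ) + 1 = j → ∃ c : k, rankOneOp A i j v = c • v)
    {M : Matrix (Fin g) (Fin g) F} (hM : M.det ≠ 0) {x : V} (hx : x ∈ lowerSpan A v) :
    A M x ∈ lowerSpan A v := by
  have hlower : ∀ i j : Fin g, j < i → ∀ c, ∀ y ∈ lowerSpan A v,
      A (transvection i j c) y ∈ lowerSpan A v := fun i j hji c y hy =>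
    apply_mem_lowerSpan_of_forall A (fun u hu => apply_mem_lowerSpan A
      ((isUnitriangular_transvection (by simpa [lowerWeight] using hji) c).mul hu)) hy
  have hupper : ∀ m : ℕ, ∀ i j : Fin g, (i : ℕ) + 1 + m = j → ∀ c, ∀ y ∈ lowerSpan A v,
      A (transvection i j c) y ∈ lowerSpan A v := by
    have conj : ∀ i j a b : Fin g, (i : ℕ) + 1 = j → ∀ c,
        (∀ y ∈ lowerSpan A v, A (transvection a b c) y ∈ lowerSpan A v) →
        ∀ y ∈ lowerSpan A v,
          A (transvection (Equiv.swap i j a) (Equiv.swap i j b) c) y ∈ lowerSpan A v := by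
      intro i j a b hij c h y hy
      have hconj : transvection (Equiv.swap i j a) (Equiv.swap i j b) c =
          swap F i j * transvection a b c * swap F i j := by
        rw [swap_mul_transvection, mul_assoc, swap_mul_self, mul_one]
      rw [hconj, map_mul, map_mul]
      exact swap_apply_mem_lowerSpan hv hij (heig i j hij)
        (h _ (swap_apply_mem_lowerSpan hv hij (heig i j hij) hy))
    intro m
    induction m with
    | zero =>
      intro i j hij c
      simpa using conj i j j i hij c (hlower j i (by rw [Fin.lt_def]; omega) c)
    | succ m ih =>
      intro i j hij c
      let l : Fin g := ⟨i + 1 + m, by omega⟩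
      have hl : (l : ℕ) = i + 1 + m := rfl
      have := conj l j i l (by omega) c (ih i l rfl c)
      rwa [Equiv.swap_apply_left, Equiv.swap_apply_of_ne_of_ne
        (by rw [ne_eq, Fin.ext_iff]; omega) (by rw [ne_eq, Fin.ext_iff]; omega)] at this
  refine diagonal_transvection_induction_of_det_ne_zero
    (fun M => ∀ y ∈ lowerSpan A v, A M y ∈ lowerSpan A v) M hM (fun d hd y hy => ?_) (fun t => ?_)
    (fun M N _ _ hM hN y hy => by rw [map_mul]; exact hM _ (hN _ hy)) x hx
  · have hd' : ∀ l, d l ≠ 0 := by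
      rw [det_diagonal, Finset.prod_ne_zero_iff] at hd
      exact fun l => hd l (Finset.mem_univ l)
    obtain ⟨c, hc⟩ := hv.2 d hd'
    refine apply_mem_lowerSpan_of_forall A (fun u hu => ?_) hy
    obtain ⟨u', hu', h⟩ := isUnitriangular_conj_diagonal hu hd'
    rw [h, map_mul, Module.End.mul_apply, hc, map_smul]
    exact Submodule.smul_mem _ _ (apply_mem_lowerSpan A hu')
  · rcases lt_or_gt_of_ne t.hij with h | h
    · exact hupper (t.j - t.i - 1) t.i t.j (by rw [Fin.lt_def] at h; omega) t.c
    · exact hlower t.i t.j h t.c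

end LowerSpan

/-- An irreducible representation of `GL` in the defining characteristic is spanned by the orbit of
some vector under the lower unitriangular matrices. -/
theorem exists_lowerSpan_eq_top {g : ℕ} {F k V : Type*} [Field F] [Finite F] [Field k]
    [IsAlgClosed k] [AddCommGroup V] [Module k V] [FiniteDimensional k V] [Nontrivial V]
    (p : ℕ) [Fact p.Prime] [CharP F p] [CharP k p] (A : Matrix (Fin g) (Fin g) F →* Module.End k V)
    (hirr : ∀ W : Submodule k V,
      (∀ M : Matrix (Fin g) (Fin g) F, M.det ≠ 0 → ∀ w ∈ W, A M w ∈ W) → W = ⊥ ∨ W = ⊤) :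
    ∃ v, lowerSpan A v = ⊤ := by
  have := Fintype.ofFinite F
  obtain ⟨v, hv, hv0, heig⟩ := exists_isHighestWeight_rankOneOp_eq_smul A (p := p)
  refine ⟨v, (hirr _ fun M hM w hw =>
    apply_mem_lowerSpan_of_det_ne_zero hv heig hM hw).resolve_left fun h => hv0 ?_⟩
  have := self_mem_lowerSpan A v
  rwa [h, Submodule.mem_bot] at this

/-- If `V` is spanned by the orbit of a vector under the lower unitriangular matrices, then all
proper subspaces invariant under these matrices lie in a common proper subspace. -/
theorem exists_ne_top_forall_le {g : ℕ} {F k V : Type*} [Field F] [Finite F] [Field k]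
    [AddCommGroup V] [Module k V] (p : ℕ) [Fact p.Prime] [CharP F p] [CharP k p]
    {A : Matrix (Fin g) (Fin g) F →* Module.End k V} {v : V} (hv : lowerSpan A v = ⊤)
    {W : Submodule k V} (hW : W ≠ ⊤)
    (hstab : ∀ u, IsUnitriangular (lowerWeight g) u → ∀ w ∈ W, A u w ∈ W) :
    ∃ N : Submodule k V, N ≠ ⊤ ∧ ∀ W' : Submodule k V, W' ≠ ⊤ →
      (∀ u, IsUnitriangular (lowerWeight g) u → ∀ w ∈ W', A u w ∈ W') → W' ≤ N := by
  let P := unitriangularSubgroup F (lowerWeight g) p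
  have hfunc : ∀ W : Submodule k V, W ≠ ⊤ →
      (∀ u, IsUnitriangular (lowerWeight g) u → ∀ w ∈ W, A u w ∈ W) →
      ∃ f : Module.Dual k V, f ≠ 0 ∧ (∀ w ∈ W, f w = 0) ∧
        ∀ u, IsUnitriangular (lowerWeight g) u → ∀ x, f (A u x) = f x := by
    intro W hW hstab
    let φ : Representation k P V := (A.comp (Units.coeHom _)).comp P.subtype
    have hφ : ∀ (u : P) x, φ u x = A (u : (Matrix (Fin g) (Fin g) F)ˣ) x := fun _ _ => rfl
    have hann : W.dualAnnihilator ≠ ⊥ := fun h =>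
      hW (Subspace.dualAnnihilator_inj.mp (h.trans Submodule.dualAnnihilator_top.symm))
    obtain ⟨f, hf, hf0, hfix⟩ :=
      (isPGroup_unitriangularSubgroup (F := F) (b := lowerWeight g) p).exists_fixed_vector
        φ.dual hann (fun u f hf => by
          rw [Submodule.mem_dualAnnihilator] at hf ⊢
          exact fun w hw => hf _ (hstab _ (u⁻¹).2 w hw))
    refine ⟨f, hf0, (Submodule.mem_dualAnnihilator f).mp hf, fun u hu x => ?_⟩
    obtain ⟨u, hu, rfl⟩ := hu.exists_unit (p := p)
    have := LinearMap.congr_fun (hfix (⟨u, hu⟩⁻¹ : P)) x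
    rw [Representation.dual_apply, inv_inv] at this
    exact this
  obtain ⟨f, hf0, -, hfix⟩ := hfunc W hW hstab
  have hfv : f v ≠ 0 := by
    intro h
    refine hf0 (LinearMap.ext_on hv ?_)
    rintro _ ⟨u, hu, rfl⟩
    simpa [h] using hfix u hu v
  refine ⟨LinearMap.ker f, fun h => hf0 (LinearMap.ker_eq_top.mp h), fun W' hW' hstab' => ?_⟩
  obtain ⟨f', hf0', hfW', hfix'⟩ := hfunc W' hW' hstab'
  have hprop : f v • f' = f' v • f := by
    refine LinearMap.ext_on hv ?_
    rintro _ ⟨u, hu, rfl⟩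
    simp [hfix u hu, hfix' u hu, mul_comm]
  have hfv' : f' v ≠ 0 := by
    intro h
    rw [h, zero_smul, smul_eq_zero] at hprop
    exact hprop.elim hfv hf0'
  intro w hw
  have := LinearMap.congr_fun hprop w
  simp only [LinearMap.smul_apply, hfW' w hw, smul_zero] at this
  rw [LinearMap.mem_ker]
  exact (smul_eq_zero.mp this.symm).resolve_left hfv'

/-- The extension by zero to all matrices of a representation of the general linear group. -/
noncomputable def extendByZero {n F R : Type*} [Fintype n] [DecidableEq n] [CommRing F] [Ring R]
    (ρ : GeneralLinearGroup n F →* Rˣ) : Matrix n n F →* R where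
  toFun M := by
    classical
    exact if h : IsUnit M then (ρ h.unit : R) else 0
  map_one' := by
    rw [dif_pos isUnit_one, IsUnit.unit_one, map_one, Units.val_one]
  map_mul' M N := by
    by_cases hM : IsUnit M
    · by_cases hN : IsUnit N
      · rw [dif_pos hM, dif_pos hN, dif_pos (hM.mul hN), ← Units.val_mul, ← map_mul]
        congr 2
        exact Units.ext rfl
      · rw [dif_neg hN, mul_zero, dif_neg fun h => hN (isUnit_of_mul_isUnit_right h)]
    · rw [dif_neg hM, zero_mul, dif_neg fun h => hM (isUnit_of_mul_isUnit_left h)]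

theorem extendByZero_coe {n F R : Type*} [Fintype n] [DecidableEq n] [CommRing F] [Ring R]
    (ρ : GeneralLinearGroup n F →* Rˣ) (M : GeneralLinearGroup n F) :
    extendByZero ρ (M : Matrix n n F) = ρ M := by
  classical
  have h : IsUnit (M : Matrix n n F) := M.isUnit
  change (if h : IsUnit (M : Matrix n n F) then (ρ h.unit : R) else 0) = _
  rw [dif_pos h]
  congr 2
  exact Units.ext rfl

end Matrix
/-- Let `p` be a prime, `q = p^a` a prime power, `k` an algebraically closed field with an
embedding of `𝔽_q`, and `ρ : GL_g(𝔽_q) → GL(V)` an irreducible representation on a nonzero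
finite-dimensional `k`-vector space `V`.  Then the restriction of `ρ` to the subgroup
`SL_g(𝔽_q)` is irreducible: every `k`-subspace `W ⊆ V` invariant under `ρ(M)` for all
`M ∈ SL_g(𝔽_q)` is `0` or `V`. -/
theorem restriction_to_SL_irreducible {p a g : ℕ} (hp : p.Prime) (ha : 0 < a)
    {F k V : Type*} [Field F] [Fintype F] (hq : Fintype.card F = p ^ a)
    [Field k] [IsAlgClosed k] (ι : F →+* k)
    [AddCommGroup V] [Module k V] [FiniteDimensional k V] [Nontrivial V]
    (ρ : Matrix.GeneralLinearGroup (Fin g) F →* (V →ₗ[k] V)ˣ)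
    (hirr : ∀ W : Submodule k V,
      (∀ (M : Matrix.GeneralLinearGroup (Fin g) F) (w : V),
        w ∈ W → (↑(ρ M) : V →ₗ[k] V) w ∈ W) →
      W = ⊥ ∨ W = ⊤) :
    ∀ W : Submodule k V,
      (∀ (S : Matrix.SpecialLinearGroup (Fin g) F) (w : V),
        w ∈ W → (↑(ρ (Matrix.SpecialLinearGroup.toGL S)) : V →ₗ[k] V) w ∈ W) →
      W = ⊥ ∨ W = ⊤ := by
  intro W hW
  have : Fact p.Prime := ⟨hp⟩
  have : CharP F p := by
    obtain ⟨r, hr⟩ := CharP.exists F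
    obtain ⟨m, hrp, hm⟩ := FiniteField.card F r
    have hdvd : r ∣ p ^ a := by
      rw [← hq, hm]
      exact dvd_pow_self r m.ne_zero
    rwa [← (Nat.prime_dvd_prime_iff_eq hrp hp).mp (hrp.dvd_of_dvd_pow hdvd)]
  have : CharP k p := charP_of_injective_ringHom ι.injective p
  let A := extendByZero ρ
  have hA : ∀ M : GeneralLinearGroup (Fin g) F, A M = ρ M := extendByZero_coe ρ
  obtain ⟨v, hv⟩ := exists_lowerSpan_eq_top p A fun U hU => hirr U fun M w hw => by
    rw [← hA]
    exact hU M (GeneralLinearGroup.det_ne_zero M) w hw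
  by_cases htop : W = ⊤
  · exact Or.inr htop
  refine Or.inl ?_
  have hlower : ∀ U : Submodule k V,
      (∀ (S : SpecialLinearGroup (Fin g) F) (w : V), w ∈ U →
        (↑(ρ (SpecialLinearGroup.toGL S)) : V →ₗ[k] V) w ∈ U) →
      ∀ u, IsUnitriangular (lowerWeight g) u → ∀ w ∈ U, A u w ∈ U := by
    intro U hU u hu w hw
    have := hU ⟨u, hu.det_eq_one (p := p)⟩ w hw
    rwa [← hA] at this
  obtain ⟨N, hN, hle⟩ := exists_ne_top_forall_le p hv htop (hlower W hW)
  have htrans : ∀ M : GeneralLinearGroup (Fin g) F, W.map (ρ M : V →ₗ[k] V) ≤ N := by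
    intro M
    refine hle _ (fun h => htop ?_) (hlower _ ?_)
    · rw [eq_top_iff]
      intro x _
      obtain ⟨w, hw, hwx⟩ : (ρ M : V →ₗ[k] V) x ∈ W.map (ρ M : V →ₗ[k] V) := h ▸ Submodule.mem_top
      have hinj : Function.Injective (ρ M : V →ₗ[k] V) :=
        ((Module.End.isUnit_iff _).mp (ρ M).isUnit).injective
      exact hinj hwx ▸ hw
    · rintro S _ ⟨w, hw, rfl⟩
      let S' : SpecialLinearGroup (Fin g) F :=
        ⟨((M⁻¹ * SpecialLinearGroup.toGL S * M : GeneralLinearGroup (Fin g) F) :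
          Matrix (Fin g) (Fin g) F), by
          rw [← GeneralLinearGroup.val_det_apply, map_mul, map_mul, mul_right_comm, map_inv,
            inv_mul_cancel, one_mul, GeneralLinearGroup.val_det_apply]
          exact S.2⟩
      have hS' : M * SpecialLinearGroup.toGL S' = SpecialLinearGroup.toGL S * M := by
        have : SpecialLinearGroup.toGL S' = M⁻¹ * SpecialLinearGroup.toGL S * M := Units.ext rfl
        rw [this, ← mul_assoc, ← mul_assoc, mul_inv_cancel, one_mul]
      refine ⟨_, hW S' w hw, ?_⟩
      rw [← Module.End.mul_apply, ← Module.End.mul_apply, ← Units.val_mul, ← Units.val_mul,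
        ← map_mul, ← map_mul, hS']
  have hsup : (⨆ M : GeneralLinearGroup (Fin g) F, W.map (ρ M : V →ₗ[k] V)) = ⊥ := by
    refine (hirr _ fun M w hw => ?_).resolve_right fun h => hN (eq_top_iff.mpr (h ▸ iSup_le htrans))
    have hmap : (⨆ M : GeneralLinearGroup (Fin g) F, W.map (ρ M : V →ₗ[k] V)).map
        (ρ M : V →ₗ[k] V) ≤ ⨆ M : GeneralLinearGroup (Fin g) F, W.map (ρ M : V →ₗ[k] V) := by
      rw [Submodule.map_iSup]
      refine iSup_le fun M' => ?_
      rw [← Submodule.map_comp, ← Module.End.mul_eq_comp, ← Units.val_mul, ← map_mul]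
      exact le_iSup (fun M : GeneralLinearGroup (Fin g) F => W.map (ρ M : V →ₗ[k] V)) (M * M')
    exact hmap (Submodule.mem_map_of_mem hw)
  rw [eq_bot_iff, ← hsup]
  refine le_trans (le_of_eq ?_)
    (le_iSup (fun M : GeneralLinearGroup (Fin g) F => W.map (ρ M : V →ₗ[k] V)) 1)
  simp [Module.End.one_eq_id]
end

section
/- Let p be a prime, k an algebraic closure of the field 𝔽_p with p elements, G a finite group, V a finite-dimensional k-vector space, and ρ : G → GL(V) a representation. Then ρ is defined over a finite field: there exist a positive integer n, a finite-dimensional vector space W over the finite field 𝔽_{p^n} with p^n elements, a representation ρ' : G → GL(W), and a k-linear isomorphism θ : k ⊗_{𝔽_{p^n}} W → V such that θ ∘ (id_k ⊗ ρ'(g)) = ρ(g) ∘ θ for all g ∈ G (where 𝔽_{p^n} is embedded in k). -/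
open scoped TensorProduct

/-- A matrix representation over `k` whose entries all lie in the image of a field `F` comes from
a matrix representation over `F`. -/
theorem exists_monoidHom_mapMatrix_eq {F k G ι : Type*} [Field F] [Field k] [Algebra F k] [Group G]
    [Fintype ι] [DecidableEq ι] (M : G →* Matrix ι ι k)
    (hM : ∀ g i j, M g i j ∈ (algebraMap F k).range) :
    ∃ N : G →* Matrix ι ι F, ∀ g, (N g).map (algebraMap F k) = M g := by
  choose N hN using hM
  have hN' : ∀ g, (algebraMap F k).mapMatrix (Matrix.of (N g)) = M g := fun g ↦ by
    ext i j
    exact hN g i j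
  have inj : Function.Injective ((algebraMap F k).mapMatrix : Matrix ι ι F →+* Matrix ι ι k) :=
    Matrix.map_injective (algebraMap F k).injective
  refine ⟨⟨⟨fun g ↦ Matrix.of (N g), inj ?_⟩, fun g h ↦ inj ?_⟩, hN'⟩
  · rw [hN', map_one, map_one]
  · rw [map_mul, hN', hN', hN', map_mul]

/-- A representation over `k` whose matrix entries in some basis all lie in the image of a field
`F` is the base change of a representation over `F`. -/
theorem exists_baseChange_equiv_of_toMatrix_mem_range {F k G V ι : Type*} [Field F] [Field k]
    [Algebra F k] [Group G] [AddCommGroup V] [Module k V] [Fintype ι] [DecidableEq ι]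
    (b : Module.Basis ι k V) (ρ : G →* (V →ₗ[k] V)ˣ)
    (hρ : ∀ g i j, LinearMap.toMatrix b b (ρ g : V →ₗ[k] V) i j ∈ (algebraMap F k).range) :
    ∃ (ρ' : G →* ((ι → F) →ₗ[F] (ι → F))ˣ) (θ : (k ⊗[F] (ι → F)) ≃ₗ[k] V),
      ∀ (g : G) (x : k ⊗[F] (ι → F)),
        θ (LinearMap.baseChange k (↑(ρ' g) : (ι → F) →ₗ[F] (ι → F)) x) =
          (↑(ρ g) : V →ₗ[k] V) (θ x) := by
  obtain ⟨N, hN⟩ := exists_monoidHom_mapMatrix_eq (F := F)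
    ((LinearMap.toMatrixAlgEquiv b : (V →ₗ[k] V) →* Matrix ι ι k).comp
      ((Units.coeHom _).comp ρ)) hρ
  let c := (Pi.basisFun F ι).baseChange k
  refine ⟨((Matrix.toLinAlgEquiv' (R := F) (n := ι)).toMulEquiv.toMonoidHom.comp N).toHomUnits,
    c.equiv b (Equiv.refl ι), fun g x ↦ ?_⟩
  refine LinearMap.congr_fun (f := (c.equiv b (Equiv.refl ι)).toLinearMap ∘ₗ
    LinearMap.baseChange k (Matrix.toLin' (N g)))
    (g := (ρ g : V →ₗ[k] V) ∘ₗ (c.equiv b (Equiv.refl ι)).toLinearMap) (c.ext fun j ↦ ?_) x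
  have hg : LinearMap.toMatrix b b (ρ g : V →ₗ[k] V) = (N g).map (algebraMap F k) := (hN g).symm
  have hc : LinearMap.baseChange k (Matrix.toLin' (N g)) (c j) =
      ∑ i, algebraMap F k (N g i j) • c i := by
    have : (N g).col j = ∑ i, N g i j • (Pi.single i 1 : ι → F) :=
      pi_eq_sum_univ' ((N g).col j)
    simp [c, this, TensorProduct.tmul_sum]
  have hb : (ρ g : V →ₗ[k] V) (b j) = ∑ i, algebraMap F k (N g i j) • b i := by
    conv_lhs => rw [← Matrix.toLin_toMatrix b b (ρ g : V →ₗ[k] V), hg, Matrix.toLin_self]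
    rfl
  simp [-algebraMap_smul, hc, hb, Module.Basis.equiv_apply]

/-- A finite subset of an algebraic extension of `𝔽_p` lies in the image of some finite field. -/
theorem exists_galoisField_ringHom_range_superset (p : ℕ) [Fact p.Prime] {k : Type*} [Field k]
    [Algebra (ZMod p) k] [Algebra.IsAlgebraic (ZMod p) k] {S : Set k} (hS : S.Finite) :
    ∃ n : ℕ, 0 < n ∧ ∃ f : GaloisField p n →+* k, S ⊆ f.range := by
  let K := IntermediateField.adjoin (ZMod p) S
  have : Finite S := hS
  have : FiniteDimensional (ZMod p) K :=
    IntermediateField.finiteDimensional_adjoin fun x _ ↦ Algebra.IsIntegral.isIntegral x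
  have : Finite K := Module.finite_of_finite (ZMod p)
  have hcard : Nat.card K = p ^ Module.finrank (ZMod p) K := by
    rw [Module.natCard_eq_pow_finrank (K := ZMod p), Nat.card_zmod]
  let e := GaloisField.algEquivGaloisField p _ hcard
  refine ⟨_, Module.finrank_pos, K.val.toRingHom.comp e.symm.toRingEquiv.toRingHom, fun x hx ↦ ?_⟩
  exact ⟨e ⟨x, IntermediateField.subset_adjoin _ _ hx⟩, by simp⟩

/-- Let `p` be a prime, `k` an algebraic closure of `𝔽_p`, `G` a finite group, and
`ρ : G → GL(V)` a representation on a finite-dimensional `k`-vector space `V`.  Then `ρ` is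
defined over a finite field: there exist `n ≥ 1`, an embedding of `𝔽_{p^n}` into `k`, a
finite-dimensional `𝔽_{p^n}`-vector space `W`, a representation `ρ' : G → GL(W)`, and a
`k`-linear isomorphism `θ : k ⊗_{𝔽_{p^n}} W ≃ V` with
`θ ∘ (id_k ⊗ ρ'(g)) = ρ(g) ∘ θ` for all `g ∈ G`. -/
theorem representation_defined_over_finite_field
    (p : ℕ) [Fact p.Prime]
    {k : Type*} [Field k] [Algebra (ZMod p) k] [IsAlgClosure (ZMod p) k]
    {G : Type*} [Group G] [Finite G]
    {V : Type*} [AddCommGroup V] [Module k V] [FiniteDimensional k V]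
    (ρ : G →* (V →ₗ[k] V)ˣ) :
    ∃ n : ℕ, 0 < n ∧
      ∃ (_ : Algebra (GaloisField p n) k) (W : Type) (_ : AddCommGroup W)
        (_ : Module (GaloisField p n) W) (_ : FiniteDimensional (GaloisField p n) W)
        (ρ' : G →* (W →ₗ[GaloisField p n] W)ˣ)
        (θ : (k ⊗[GaloisField p n] W) ≃ₗ[k] V),
        ∀ (g : G) (x : k ⊗[GaloisField p n] W),
          θ (LinearMap.baseChange k (↑(ρ' g) : W →ₗ[GaloisField p n] W) x) =
            (↑(ρ g) : V →ₗ[k] V) (θ x) := by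
  have : Algebra.IsAlgebraic (ZMod p) k := IsAlgClosure.isAlgebraic
  let b := Module.finBasis k V
  obtain ⟨n, hn, f, hf⟩ := exists_galoisField_ringHom_range_superset p
    (Set.finite_range fun x : G × Fin (Module.finrank k V) × Fin (Module.finrank k V) ↦
      LinearMap.toMatrix b b (ρ x.1 : V →ₗ[k] V) x.2.1 x.2.2)
  let _ : Algebra (GaloisField p n) k := f.toAlgebra
  exact ⟨n, hn, f.toAlgebra, Fin (Module.finrank k V) → GaloisField p n, inferInstance,
    inferInstance, inferInstance, exists_baseChange_equiv_of_toMatrix_mem_range b ρ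
      fun g i j ↦ hf ⟨(g, i, j), rfl⟩⟩
end
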